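/- Let V(ρ) = 72(36 − 14√6 + (√6 − 2)ρ²)/(36 − 14√6 + √6 ρ²)². There exists a constant C > 0 such that for every radial u ∈ C_c^∞(ℝ⁷) and every R ≥ 1, writing (V·u)(x) := V(|x|)u(x): ‖Δ(V·u)‖_{H¹(ℝ⁷)} + ‖Δ²(V·u)‖_{L²(ℝ⁷)} ≤ C ‖u‖, and ‖Δ(V·u)‖_{H¹(ℝ⁷ ∖ B_R)} + ‖Δ²(V·u)‖_{L²(ℝ⁷ ∖ B_R)} ≤ C R^{−1} ‖u‖, where B_R is the ball of radius R centered at the origin in ℝ⁷. -/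

import Mathlib

open MeasureTheory Set
open scoped ENNReal

noncomputable section

abbrev E7 := EuclideanSpace ℝ (Fin 7)

/-- The Laplacian on `ℝ⁷`: `Δf(x) = ∑ᵢ ∂ᵢ²f(x)`. -/
def lap (f : E7 → ℝ) (x : E7) : ℝ :=
  ∑ i : Fin 7, iteratedFDeriv ℝ 2 f x ![EuclideanSpace.single i 1, EuclideanSpace.single i 1]

/-- A function on `ℝ⁷` is radial if it only depends on the norm of its argument. -/
def IsRadial (f : E7 → ℝ) : Prop := ∀ x y : E7, ‖x‖ = ‖y‖ → f x = f y

/-- `‖f‖² = ‖Δf‖²_{L²(ℝ⁷)} + ‖Δ²f‖²_{L²(ℝ⁷)}`. -/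
def HnormSq (f : E7 → ℝ) : ℝ≥0∞ :=
  (∫⁻ x, ENNReal.ofReal ((lap f x)^2)) + (∫⁻ x, ENNReal.ofReal ((lap (lap f) x)^2))

/-- `‖f‖ = (‖Δf‖² + ‖Δ²f‖²)^{1/2}`. -/
def Hnorm (f : E7 → ℝ) : ℝ≥0∞ := HnormSq f ^ ((1:ℝ)/2)

/-- The square of the `H¹(s)` norm of `f` on a set `s ⊆ ℝ⁷`. -/
def H1normSq (f : E7 → ℝ) (s : Set E7) : ℝ≥0∞ :=
  (∫⁻ x in s, ENNReal.ofReal ((f x)^2)) + (∫⁻ x in s, ENNReal.ofReal (‖fderiv ℝ f x‖^2))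

/-- The potential `V(ρ) = 72(36 − 14√6 + (√6 − 2)ρ²)/(36 − 14√6 + √6 ρ²)²`. -/
def Vpot (ρ : ℝ) : ℝ :=
  72 * (36 - 14 * Real.sqrt 6 + (Real.sqrt 6 - 2) * ρ^2) /
    (36 - 14 * Real.sqrt 6 + Real.sqrt 6 * ρ^2)^2

/-! ### Basic calculus of partial derivatives -/

/-- Smoothness abbreviation. -/
abbrev Sm (f : E7 → ℝ) : Prop := ContDiff ℝ (⊤ : ℕ∞) f

/-- Standard basis vector. -/
abbrev ev (i : Fin 7) : E7 := EuclideanSpace.single i (1:ℝ)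

/-- Partial derivative. -/
def pd (i : Fin 7) (f : E7 → ℝ) (x : E7) : ℝ := fderiv ℝ f x (ev i)

/-- The Euler operator `x · ∇`. -/
def eul (f : E7 → ℝ) (x : E7) : ℝ := ∑ i : Fin 7, x i * pd i f x

/-- The squared gradient. -/
def grsq (f : E7 → ℝ) (x : E7) : ℝ := ∑ i : Fin 7, (pd i f x)^2

theorem Sm.diffAt {f : E7 → ℝ} (hf : Sm f) (x : E7) : DifferentiableAt ℝ f x :=
  (hf.differentiable (by simp)) x

theorem Sm.fd {f : E7 → ℝ} (hf : Sm f) : ContDiff ℝ (⊤ : ℕ∞) (fderiv ℝ f) :=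
  hf.fderiv_right (by simp)

theorem Sm.pd {f : E7 → ℝ} (hf : Sm f) (i : Fin 7) : Sm (pd i f) :=
  hf.fd.clm_apply contDiff_const

theorem pd_pd {f : E7 → ℝ} (hf : Sm f) (i j : Fin 7) (x : E7) :
    pd i (pd j f) x = fderiv ℝ (fderiv ℝ f) x (ev i) (ev j) := by
  have h : DifferentiableAt ℝ (fderiv ℝ f) x := (hf.fd.differentiable (by simp)) x
  have := (h.hasFDerivAt.clm_apply (hasFDerivAt_const (ev j) x)).fderiv
  change fderiv ℝ (fun y => fderiv ℝ f y (ev j)) x (ev i) = _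
  rw [this]
  simp

theorem pd_comm {f : E7 → ℝ} (hf : Sm f) (i j : Fin 7) (x : E7) :
    pd i (pd j f) x = pd j (pd i f) x := by
  rw [pd_pd hf, pd_pd hf]
  have h : IsSymmSndFDerivAt ℝ f x := hf.contDiffAt.isSymmSndFDerivAt (by simp; exact WithTop.coe_le_coe.mpr le_top)
  exact h _ _

theorem lap_eq {f : E7 → ℝ} (hf : Sm f) (x : E7) : lap f x = ∑ i, pd i (pd i f) x := by
  unfold lap
  refine Finset.sum_congr rfl fun i _ => ?_
  rw [iteratedFDeriv_two_apply, pd_pd hf]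
  simp

theorem lap_fun {f : E7 → ℝ} (hf : Sm f) : lap f = fun x => ∑ i, pd i (pd i f) x :=
  funext (lap_eq hf)

theorem Sm.lap {f : E7 → ℝ} (hf : Sm f) : Sm (lap f) := by
  rw [lap_fun hf]
  exact ContDiff.sum fun i _ => (hf.pd i).pd i

theorem sm_coord (i : Fin 7) : Sm (fun x : E7 => x i) :=
  (EuclideanSpace.proj (𝕜 := ℝ) i).contDiff

theorem Sm.eul {f : E7 → ℝ} (hf : Sm f) : Sm (eul f) :=
  ContDiff.sum fun i _ => (sm_coord i).mul (hf.pd i)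

theorem pd_mul {f g : E7 → ℝ} (hf : Sm f) (hg : Sm g) (i : Fin 7) (x : E7) :
    pd i (fun y => f y * g y) x = pd i f x * g x + f x * pd i g x := by
  unfold pd
  rw [((hf.diffAt x).hasFDerivAt.fun_mul (hg.diffAt x).hasFDerivAt).fderiv]
  simp; ring

theorem pd_add {f g : E7 → ℝ} (hf : Sm f) (hg : Sm g) (i : Fin 7) (x : E7) :
    pd i (fun y => f y + g y) x = pd i f x + pd i g x := by
  unfold pd
  rw [((hf.diffAt x).hasFDerivAt.fun_add (hg.diffAt x).hasFDerivAt).fderiv]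
  simp

theorem pd_const_mul {f : E7 → ℝ} (hf : Sm f) (c : ℝ) (i : Fin 7) (x : E7) :
    pd i (fun y => c * f y) x = c * pd i f x := by
  unfold pd
  rw [((hf.diffAt x).hasFDerivAt.const_mul c).fderiv]
  simp

theorem pd_sub {f g : E7 → ℝ} (hf : Sm f) (hg : Sm g) (i : Fin 7) (x : E7) :
    pd i (fun y => f y - g y) x = pd i f x - pd i g x := by
  unfold pd
  rw [((hf.diffAt x).hasFDerivAt.fun_sub (hg.diffAt x).hasFDerivAt).fderiv]
  simp

theorem pd_sum {f : Fin 7 → E7 → ℝ} (hf : ∀ j, Sm (f j)) (i : Fin 7) (x : E7) :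
    pd i (fun y => ∑ j, f j y) x = ∑ j, pd i (f j) x := by
  unfold pd
  rw [(HasFDerivAt.fun_sum fun j _ => ((hf j).diffAt x).hasFDerivAt).fderiv]
  simp

theorem pd_coord (i j : Fin 7) (x : E7) :
    pd i (fun y : E7 => y j) x = if i = j then 1 else 0 := by
  unfold pd
  have : HasFDerivAt (fun y : E7 => y j) (EuclideanSpace.proj (𝕜 := ℝ) j : E7 →L[ℝ] ℝ) x :=
    (EuclideanSpace.proj (𝕜 := ℝ) j : E7 →L[ℝ] ℝ).hasFDerivAt
  rw [this.fderiv]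
  simp [eq_comm]

theorem lap_add {f g : E7 → ℝ} (hf : Sm f) (hg : Sm g) (x : E7) :
    lap (fun y => f y + g y) x = lap f x + lap g x := by
  rw [lap_eq (hf.add hg), lap_eq hf, lap_eq hg, ← Finset.sum_add_distrib]
  refine Finset.sum_congr rfl fun i _ => ?_
  rw [funext (pd_add hf hg i), pd_add (hf.pd i) (hg.pd i)]

theorem lap_mul {f g : E7 → ℝ} (hf : Sm f) (hg : Sm g) (x : E7) :
    lap (fun y => f y * g y) x
      = f x * lap g x + 2 * ∑ i, pd i f x * pd i g x + lap f x * g x := by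
  rw [lap_eq (hf.mul hg), lap_eq hf, lap_eq hg, Finset.mul_sum, Finset.mul_sum, Finset.sum_mul,
    ← Finset.sum_add_distrib, ← Finset.sum_add_distrib]
  refine Finset.sum_congr rfl fun i _ => ?_
  rw [funext (pd_mul hf hg i), pd_add ((hf.pd i).mul hg) (hf.mul (hg.pd i)),
    pd_mul (hf.pd i) hg, pd_mul hf (hg.pd i)]
  ring

/-! ### Radial functions -/

theorem fderiv_radial {u : E7 → ℝ} (hu : Sm u) (hr : IsRadial u) (x v : E7)
    (hv : inner ℝ x v = 0) : fderiv ℝ u x v = 0 := by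
  by_cases hv0 : v = 0
  · simp [hv0]
  by_cases hx0 : x = 0
  · -- even function
    subst hx0
    have h1 : HasDerivAt (fun t : ℝ => u (t • v)) (fderiv ℝ u 0 v) 0 := by
      have h2 : HasDerivAt (fun t : ℝ => t • v) v 0 := by
        simpa using (hasDerivAt_id (0:ℝ)).smul_const v
      have h3 : HasFDerivAt u (fderiv ℝ u 0) ((0:ℝ) • v) := by
        rw [zero_smul]; exact (hu.diffAt 0).hasFDerivAt
      exact h3.comp_hasDerivAt 0 h2
    have h4 : HasDerivAt (fun t : ℝ => u (t • v)) (-fderiv ℝ u 0 v) 0 := by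
      have h2 : HasDerivAt (fun t : ℝ => t • (-v)) (-v) 0 := by
        simpa using (hasDerivAt_id (0:ℝ)).smul_const (-v)
      have h3 : HasFDerivAt u (fderiv ℝ u 0) ((0:ℝ) • (-v)) := by
        rw [zero_smul]; exact (hu.diffAt 0).hasFDerivAt
      have h5 := h3.comp_hasDerivAt 0 h2
      rw [map_neg] at h5
      refine h5.congr_of_eventuallyEq (Filter.Eventually.of_forall fun t => ?_)
      exact hr _ _ (by simp)
    have := h1.unique h4
    linarith
  have hvn : ‖v‖ ≠ 0 := norm_ne_zero_iff.mpr hv0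
  have hxn : ‖x‖ ≠ 0 := norm_ne_zero_iff.mpr hx0
  set c : ℝ := ‖x‖ / ‖v‖ with hc
  have hc0 : c ≠ 0 := div_ne_zero hxn hvn
  set w : E7 := c • v with hw
  have hwn : ‖w‖ = ‖x‖ := by
    rw [hw, norm_smul, hc, Real.norm_eq_abs, abs_of_nonneg (by positivity)]
    field_simp
  have hxw : inner ℝ x w = 0 := by rw [hw, inner_smul_right, hv, mul_zero]
  have hγ : HasDerivAt (fun t : ℝ => Real.cos t • x + Real.sin t • w) w 0 := by
    have := ((Real.hasDerivAt_cos 0).smul_const x).fun_add ((Real.hasDerivAt_sin 0).smul_const w)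
    simpa using this
  have hconst : ∀ t : ℝ, u (Real.cos t • x + Real.sin t • w) = u x := by
    intro t
    apply hr
    have : ‖Real.cos t • x + Real.sin t • w‖^2 = ‖x‖^2 := by
      rw [norm_add_sq_real, inner_smul_left, inner_smul_right, hxw, norm_smul, norm_smul, hwn]
      simp only [Real.norm_eq_abs, mul_pow, sq_abs]
      have := Real.sin_sq_add_cos_sq t
      simp only [mul_zero, add_zero]
      rw [← add_mul, add_comm, this, one_mul]
    exact (sq_eq_sq₀ (norm_nonneg _) (norm_nonneg _)).mp this
  have h1 : HasDerivAt (fun t : ℝ => u (Real.cos t • x + Real.sin t • w)) (fderiv ℝ u x w) 0 := by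
    have h3 : HasFDerivAt u (fderiv ℝ u x) (Real.cos 0 • x + Real.sin 0 • w) := by
      simpa using (hu.diffAt x).hasFDerivAt
    exact h3.comp_hasDerivAt 0 hγ
  have h2 : HasDerivAt (fun t : ℝ => u (Real.cos t • x + Real.sin t • w)) 0 0 := by
    simp_rw [hconst]; exact hasDerivAt_const _ _
  have h3 := h1.unique h2
  rw [hw, map_smul, smul_eq_mul] at h3
  exact (mul_eq_zero.mp h3).resolve_left hc0

theorem rot_radial {u : E7 → ℝ} (hu : Sm u) (hr : IsRadial u) (i j : Fin 7) (x : E7) :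
    x i * pd j u x = x j * pd i u x := by
  have := fderiv_radial hu hr x (x i • ev j - x j • ev i) (by
    rw [inner_sub_right, inner_smul_right, inner_smul_right]
    simp [EuclideanSpace.inner_single_right]; ring)
  rw [map_sub, map_smul, map_smul] at this
  unfold pd
  simpa [sub_eq_zero] using this

theorem pd_eul {u : E7 → ℝ} (hu : Sm u) (hr : IsRadial u) (j : Fin 7) (x : E7) :
    pd j (eul u) x = x j * lap u x - 5 * pd j u x := by
  have h1 : pd j (eul u) x = pd j u x + ∑ i, x i * pd i (pd j u) x := by
    have : pd j (eul u) x = ∑ i, pd j (fun y : E7 => y i * pd i u y) x :=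
      pd_sum (fun i => (sm_coord i).mul (hu.pd i)) j x
    rw [this]
    have h : ∀ i, pd j (fun y : E7 => y i * pd i u y) x
        = (if j = i then pd i u x else 0) + x i * pd i (pd j u) x := by
      intro i
      rw [pd_mul (sm_coord i) (hu.pd i), pd_coord, pd_comm hu j i]
      simp
    simp_rw [h]
    rw [Finset.sum_add_distrib]
    simp
  have h2 : ∀ i, (pd j u x + x i * pd i (pd j u) x)
      = (if i = j then pd i u x else 0) + x j * pd i (pd i u) x := by
    intro i
    have ha := pd_mul (sm_coord i) (hu.pd j) i x
    have hb := pd_mul (sm_coord j) (hu.pd i) i x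
    rw [funext (rot_radial hu hr i j), hb, pd_coord, pd_coord] at ha
    simp only [if_true, one_mul] at ha
    rw [← ha]
    simp
  have h3 := Finset.sum_congr (rfl : (Finset.univ : Finset (Fin 7)) = Finset.univ) (fun i _ => h2 i)
  rw [Finset.sum_add_distrib, Finset.sum_add_distrib, ← Finset.mul_sum, ← lap_eq hu] at h3
  simp only [Finset.sum_const, Finset.card_univ, Fintype.card_fin, nsmul_eq_mul, Finset.sum_ite_eq',
    Finset.mem_univ, if_true] at h3
  rw [h1]
  push_cast at h3
  linarith

theorem lap_eul {u : E7 → ℝ} (hu : Sm u) (hr : IsRadial u) (x : E7) :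
    lap (eul u) x = 2 * lap u x + eul (lap u) x := by
  rw [lap_eq hu.eul]
  have h : ∀ i, pd i (pd i (eul u)) x = lap u x + x i * pd i (lap u) x - 5 * pd i (pd i u) x := by
    intro i
    rw [funext (pd_eul hu hr i), pd_sub ((sm_coord i).mul hu.lap) (contDiff_const.mul (hu.pd i)),
      pd_mul (sm_coord i) hu.lap, pd_const_mul (hu.pd i), pd_coord]
    simp
  simp_rw [h]
  rw [Finset.sum_sub_distrib, Finset.sum_add_distrib, ← Finset.mul_sum, ← lap_eq hu]
  simp only [Finset.sum_const, Finset.card_univ, Fintype.card_fin, nsmul_eq_mul]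
  unfold eul
  push_cast
  ring

theorem eul_eul {u : E7 → ℝ} (hu : Sm u) (hr : IsRadial u) (x : E7) :
    eul (eul u) x = ‖x‖^2 * lap u x - 5 * eul u x := by
  have : eul (eul u) x = ∑ i, x i * pd i (eul u) x := rfl
  rw [this, EuclideanSpace.real_norm_sq_eq]
  simp_rw [pd_eul hu hr]
  unfold eul
  rw [Finset.sum_mul, Finset.mul_sum, ← Finset.sum_sub_distrib]
  exact Finset.sum_congr rfl fun i _ => by ring

/-! ### The weight and radial multipliers -/

/-- First constant. -/
def ca : ℝ := 36 - 14 * Real.sqrt 6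
/-- Second constant. -/
def cb : ℝ := Real.sqrt 6
/-- The weight `a + b |x|²`. -/
def qw (x : E7) : ℝ := ca + cb * ‖x‖^2
/-- The inverse weight. -/
def mw (x : E7) : ℝ := (qw x)⁻¹

theorem cb_sq : cb^2 = 6 := Real.sq_sqrt (by norm_num)
theorem cb_pos : 0 < cb := Real.sqrt_pos.mpr (by norm_num)
theorem ca_eq : ca = 36 - 14 * cb := rfl
theorem ca_pos : 0 < ca := by
  have := cb_sq; have := cb_pos; have := ca_eq
  nlinarith
theorem ca_le_cb : ca ≤ cb := by
  have := cb_sq; have := cb_pos; have := ca_eq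
  nlinarith
theorem qw_pos (x : E7) : 0 < qw x := by
  have := ca_pos; have := cb_pos
  unfold qw; positivity
theorem mw_pos (x : E7) : 0 < mw x := inv_pos.mpr (qw_pos x)
theorem ca_le_qw (x : E7) : ca ≤ qw x := by
  have := cb_pos
  have : 0 ≤ cb * ‖x‖^2 := by positivity
  unfold qw; linarith
theorem mw_le (x : E7) : mw x ≤ ca⁻¹ := inv_anti₀ ca_pos (ca_le_qw x)
theorem mw_qw (x : E7) : mw x * qw x = 1 := inv_mul_cancel₀ (qw_pos x).ne'
theorem s_mw (x : E7) : cb * ‖x‖^2 * mw x = 1 - ca * mw x := by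
  have := mw_qw x
  unfold qw at this
  linarith
theorem s_mw_le (x : E7) : ‖x‖^2 * mw x ≤ cb⁻¹ := by
  have h1 := s_mw x
  have h2 := mul_pos ca_pos (mw_pos x)
  rw [← one_div, le_div_iff₀ cb_pos]
  linarith

theorem qw_hasF (x : E7) : HasFDerivAt qw (cb • (2 • innerSL ℝ x)) x :=
  ((hasStrictFDerivAt_norm_sq x).hasFDerivAt.const_mul cb).const_add ca

theorem sm_qw : Sm qw := contDiff_const.add (contDiff_const.mul (contDiff_norm_sq ℝ))
theorem sm_mw : Sm mw := sm_qw.inv fun x => (qw_pos x).ne'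

theorem pd_qw (i : Fin 7) (x : E7) : pd i qw x = 2 * cb * x i := by
  unfold pd
  rw [(qw_hasF x).fderiv]
  simp [EuclideanSpace.inner_single_right]
  ring

theorem mw_hasF (x : E7) : HasFDerivAt mw (-(mw x)^2 • (cb • (2 • innerSL ℝ x))) x := by
  have := (hasDerivAt_inv (qw_pos x).ne').comp_hasFDerivAt x (qw_hasF x)
  have e : -(qw x ^ 2)⁻¹ = -(mw x)^2 := by unfold mw; rw [inv_pow]
  rw [e] at this
  exact this

open Polynomial in
/-- Radial multiplier: a polynomial in the inverse weight. -/
def Fm (P : ℝ[X]) (x : E7) : ℝ := P.eval (mw x)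

open Polynomial in
/-- `2 ∂ᵢ F_P = xᵢ F_{γ P}`. -/
def gam (P : ℝ[X]) : ℝ[X] := C (-4 * cb) * X^2 * derivative P

open Polynomial in
/-- `Δ F_P = F_{η P}`. -/
def etp (P : ℝ[X]) : ℝ[X] := C (7/2) * gam P - (1 - C ca * X) * X * derivative (gam P)

open Polynomial in
theorem sm_Fm (P : ℝ[X]) : Sm (Fm P) := by
  have h : ContDiff ℝ (⊤ : ℕ∞) (fun t : ℝ => P.eval t) := by
    simpa using P.contDiff_aeval (𝕜 := ℝ) (R := ℝ) (⊤ : ℕ∞)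
  exact h.comp sm_mw

open Polynomial in
theorem pd_Fm (P : ℝ[X]) (i : Fin 7) (x : E7) : pd i (Fm P) x = x i * ((1/2) * Fm (gam P) x) := by
  have := (P.hasDerivAt (mw x)).comp_hasFDerivAt x (mw_hasF x)
  unfold pd
  change fderiv ℝ ((fun y => eval y P) ∘ mw) x (ev i) = _
  rw [this.fderiv]
  simp [EuclideanSpace.inner_single_right, Fm, gam]
  ring

open Polynomial in
theorem lap_Fm (P : ℝ[X]) (x : E7) : lap (Fm P) x = Fm (etp P) x := by
  rw [lap_eq (sm_Fm P)]
  have h : ∀ i, pd i (pd i (Fm P)) x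
      = (1/2) * Fm (gam P) x + (x i)^2 * ((1/4) * Fm (gam (gam P)) x) := by
    intro i
    rw [funext (pd_Fm P i), pd_mul (sm_coord i) (contDiff_const.mul (sm_Fm _)),
      pd_const_mul (sm_Fm _), pd_Fm, pd_coord]
    simp
    ring
  simp_rw [h]
  rw [Finset.sum_add_distrib, ← Finset.sum_mul (s := Finset.univ) (f := fun i => x i ^ 2), ← EuclideanSpace.real_norm_sq_eq]
  simp only [Finset.sum_const, Finset.card_univ, Fintype.card_fin, nsmul_eq_mul]
  have h2 : Fm (gam (gam P)) x = -4 * cb * mw x ^ 2 * Fm (derivative (gam P)) x := by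
    simp [Fm, gam]
  have h3 : Fm (etp P) x = 7/2 * Fm (gam P) x
      - (1 - ca * mw x) * mw x * Fm (derivative (gam P)) x := by
    simp [Fm, etp]
  rw [h2, h3, ← s_mw]
  push_cast
  ring

open Polynomial in
theorem lap_Fm_mul (P : ℝ[X]) {y : E7 → ℝ} (hy : Sm y) (x : E7) :
    lap (fun z => Fm P z * y z) x
      = Fm P x * lap y x + Fm (gam P) x * eul y x + Fm (etp P) x * y x := by
  rw [lap_mul (sm_Fm P) hy, lap_Fm]
  congr 2
  unfold eul
  rw [Finset.mul_sum, Finset.mul_sum]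
  refine Finset.sum_congr rfl fun i _ => ?_
  rw [pd_Fm]; ring

open Polynomial in
theorem dvd_gam {k : ℕ} {P : ℝ[X]} (h : X^(k+1) ∣ P) : X^(k+2) ∣ gam P := by
  obtain ⟨Q, rfl⟩ := h
  refine ⟨C (-4 * cb) * (C ((k:ℝ)+1) * Q + X * derivative Q), ?_⟩
  simp [gam, derivative_mul]
  ring

open Polynomial in
theorem dvd_etp {k : ℕ} {P : ℝ[X]} (h : X^(k+1) ∣ P) : X^(k+2) ∣ etp P := by
  have h1 := dvd_gam h
  obtain ⟨Q, hQ⟩ := h1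
  refine ⟨C (7/2) * Q - (1 - C ca * X) * (C ((k:ℝ)+2) * Q + X * derivative Q), ?_⟩
  rw [etp, hQ]
  have h2 : (C 2 : ℝ[X]) = 2 := rfl
  simp [derivative_mul, h2]
  ring

open Polynomial in
theorem Fm_bound {k : ℕ} {P : ℝ[X]} (h : X^k ∣ P) :
    ∃ K : ℝ, 0 ≤ K ∧ ∀ x, (Fm P x)^2 ≤ K * (mw x)^(2*k) := by
  obtain ⟨Q, rfl⟩ := h
  obtain ⟨M, hM⟩ := (isCompact_Icc (a := (0:ℝ)) (b := ca⁻¹)).exists_bound_of_continuousOn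
    (f := fun t => Q.eval t) Q.continuous.continuousOn
  refine ⟨M^2, sq_nonneg _, fun x => ?_⟩
  have := hM (mw x) ⟨(mw_pos x).le, mw_le x⟩
  have h2 : (Q.eval (mw x))^2 ≤ M^2 := by
    rw [← sq_abs]; exact pow_le_pow_left₀ (abs_nonneg _) this 2
  have h3 : (Fm (X^k * Q) x)^2 = (mw x)^(2*k) * (Q.eval (mw x))^2 := by
    simp [Fm]; ring
  rw [h3, mul_comm]
  exact mul_le_mul_of_nonneg_right h2 (pow_nonneg (mw_pos x).le _)

open Polynomial in
/-- The polynomial representing the potential. -/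
def PV : ℝ[X] := C (72 * (1 - 2 / cb)) * X + C (144 * ca / cb) * X^2

open Polynomial in
theorem dvd_PV : X^(0+1) ∣ PV := ⟨C (72 * (1 - 2 / cb)) + C (144 * ca / cb) * X, by
  unfold PV; ring⟩

theorem Vpot_eq (x : E7) : Vpot ‖x‖ = Fm PV x := by
  have hq := (qw_pos x).ne'
  have hb := cb_pos.ne'
  have : Vpot ‖x‖ = 72 * (ca + (cb - 2) * ‖x‖^2) / (qw x)^2 := rfl
  rw [this]
  simp only [Fm, PV, mw, Polynomial.eval_add, Polynomial.eval_mul, Polynomial.eval_C,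
    Polynomial.eval_X, Polynomial.eval_pow]
  field_simp
  unfold qw
  ring

/-! ### Integration by parts -/

theorem cs_pd {f : E7 → ℝ} (hf : HasCompactSupport f) (i : Fin 7) : HasCompactSupport (pd i f) :=
  hf.fderiv_apply ℝ (ev i)

theorem cs_sum {f : Fin 7 → E7 → ℝ} (hf : ∀ i, HasCompactSupport (f i)) :
    HasCompactSupport (fun x => ∑ i, f i x) := by
  simp only [Fin.sum_univ_seven]
  exact ((((((hf 0).add (hf 1)).add (hf 2)).add (hf 3)).add (hf 4)).add (hf 5)).add (hf 6)

theorem cs_lap {f : E7 → ℝ} (h : Sm f) (hf : HasCompactSupport f) : HasCompactSupport (lap f) := by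
  rw [lap_fun h]
  exact cs_sum fun i => cs_pd (cs_pd hf i) i

theorem integral_pd {f : E7 → ℝ} (h : Sm f) (hf : HasCompactSupport f) (i : Fin 7) :
    ∫ x, pd i f x = 0 := by
  have h1 : Integrable (fun x => pd i f x) :=
    (h.pd i).continuous.integrable_of_hasCompactSupport (cs_pd hf i)
  have h2 : Integrable f := h.continuous.integrable_of_hasCompactSupport hf
  have := integral_mul_fderiv_eq_neg_fderiv_mul_of_integrable (μ := (volume : Measure E7))
    (f := fun _ : E7 => (1:ℝ)) (g := f) (v := ev i) (by simp) (by simpa [pd] using h1) (by simpa using h2)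
    (fun x _ => by fun_prop) (fun x _ => h.diffAt x)
  simpa [pd] using this

theorem ibp_le {L R : E7 → ℝ} {Y : Fin 7 → E7 → ℝ} (hL : Integrable L) (hR : Integrable R)
    (hY : ∀ i, Sm (Y i)) (hYc : ∀ i, HasCompactSupport (Y i))
    (h : ∀ x, L x ≤ R x + ∑ i, pd i (Y i) x) : ∫ x, L x ≤ ∫ x, R x := by
  have hi : ∀ i, Integrable (fun x => pd i (Y i) x) := fun i =>
    ((hY i).pd i).continuous.integrable_of_hasCompactSupport (cs_pd (hYc i) i)
  have hs : Integrable (fun x => ∑ i, pd i (Y i) x) := integrable_finsetSum _ fun i _ => hi i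
  have h0 : ∫ x, ∑ i, pd i (Y i) x = 0 := by
    rw [integral_finsetSum _ fun i _ => hi i]
    exact Finset.sum_eq_zero fun i _ => integral_pd (hY i) (hYc i) i
  calc ∫ x, L x ≤ ∫ x, (R x + ∑ i, pd i (Y i) x) := integral_mono hL (hR.add hs) h
    _ = ∫ x, R x := by rw [integral_add hR hs, h0, add_zero]

theorem pd_mw (i : Fin 7) (x : E7) : pd i mw x = -2 * cb * x i * (mw x)^2 := by
  unfold pd
  rw [(mw_hasF x).fderiv]
  simp [EuclideanSpace.inner_single_right]
  ring

theorem div_grad {w : E7 → ℝ} (hw : Sm w) (x : E7) :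
    ∑ i, pd i (fun y => w y * pd i w y) x = grsq w x + w x * lap w x := by
  rw [lap_eq hw, grsq, Finset.mul_sum, ← Finset.sum_add_distrib]
  refine Finset.sum_congr rfl fun i _ => ?_
  rw [pd_mul hw (hw.pd i)]; ring

theorem div_mul_grad {w g : E7 → ℝ} (hw : Sm w) (hg : Sm g) (x : E7) :
    ∑ i, pd i (fun y => g y * (w y * pd i w y)) x
      = g x * (grsq w x + w x * lap w x) + w x * ∑ i, pd i g x * pd i w x := by
  rw [← div_grad hw, Finset.mul_sum, Finset.mul_sum, ← Finset.sum_add_distrib]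
  refine Finset.sum_congr rfl fun i _ => ?_
  rw [pd_mul hg (hw.mul (hw.pd i))]; ring

theorem div_q {w : E7 → ℝ} (hw : Sm w) (x : E7) :
    ∑ i, pd i (fun y => qw y * (w y * pd i w y)) x
      = qw x * (grsq w x + w x * lap w x) + 2 * cb * w x * eul w x := by
  rw [div_mul_grad hw sm_qw, eul, Finset.mul_sum, Finset.mul_sum]
  congr 1
  refine Finset.sum_congr rfl fun i _ => ?_
  rw [pd_qw]; ring

theorem div_m {w : E7 → ℝ} (hw : Sm w) (x : E7) :
    ∑ i, pd i (fun y => mw y * (w y * pd i w y)) x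
      = mw x * (grsq w x + w x * lap w x) - 2 * cb * (mw x)^2 * w x * eul w x := by
  rw [div_mul_grad hw sm_mw, eul, Finset.mul_sum, Finset.mul_sum, sub_eq_add_neg,
    ← Finset.sum_neg_distrib]
  congr 1
  refine Finset.sum_congr rfl fun i _ => ?_
  rw [pd_mw]; ring

theorem div_x {w : E7 → ℝ} (hw : Sm w) (x : E7) :
    ∑ i, pd i (fun y : E7 => y i * (cb * ((mw y * mw y) * (w y * w y)))) x
      = cb * (w x)^2 * (3 * (mw x)^2 + 4 * ca * (mw x)^3)
        + 2 * cb * (mw x)^2 * w x * eul w x := by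
  have hm2 : Sm (fun y => mw y * mw y) := sm_mw.mul sm_mw
  have hw2 : Sm (fun y => w y * w y) := hw.mul hw
  have h : ∀ i, pd i (fun y : E7 => y i * (cb * ((mw y * mw y) * (w y * w y)))) x
      = cb * (mw x)^2 * (w x)^2 + (x i)^2 * (-4 * cb^2 * (mw x)^3 * (w x)^2)
        + 2 * cb * (mw x)^2 * w x * (x i * pd i w x) := by
    intro i
    rw [pd_mul (sm_coord i) (contDiff_const.mul (hm2.mul hw2)), pd_const_mul (hm2.mul hw2),
      pd_mul hm2 hw2, pd_mul sm_mw sm_mw, pd_mul hw hw, pd_mw, pd_coord]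
    simp
    ring
  simp_rw [h]
  rw [Finset.sum_add_distrib, Finset.sum_add_distrib,
    ← Finset.sum_mul (s := Finset.univ) (f := fun i => x i ^ 2),
    ← EuclideanSpace.real_norm_sq_eq,
    ← Finset.mul_sum (s := Finset.univ) (f := fun i => x i * pd i w x)]
  change _ + 2 * cb * (mw x)^2 * w x * eul w x = _
  simp only [Finset.sum_const, Finset.card_univ, Fintype.card_fin, nsmul_eq_mul]
  have := s_mw x
  push_cast
  linear_combination (-4 * cb * (mw x)^2 * (w x)^2) * this

theorem grsq_nonneg (f : E7 → ℝ) (x : E7) : 0 ≤ grsq f x :=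
  Finset.sum_nonneg fun _ _ => sq_nonneg _

theorem eul_sq (f : E7 → ℝ) (x : E7) : (eul f x)^2 ≤ ‖x‖^2 * grsq f x := by
  rw [EuclideanSpace.real_norm_sq_eq]
  exact Finset.sum_mul_sq_le_sq_mul_sq _ _ _

theorem fderiv_sq_le (f : E7 → ℝ) (x : E7) : ‖fderiv ℝ f x‖^2 ≤ grsq f x := by
  have h : ‖fderiv ℝ f x‖ ≤ Real.sqrt (grsq f x) := by
    refine ContinuousLinearMap.opNorm_le_bound _ (Real.sqrt_nonneg _) fun v => ?_
    have hv : v = ∑ i, v i • ev i := by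
      ext j
      simp [Pi.single_apply]
    have h1 : fderiv ℝ f x v = ∑ i, v i * pd i f x := by
      conv_lhs => rw [hv]
      rw [map_sum]
      simp [pd]
    have h2 : (fderiv ℝ f x v)^2 ≤ grsq f x * ‖v‖^2 := by
      rw [h1, EuclideanSpace.real_norm_sq_eq, mul_comm]
      exact Finset.sum_mul_sq_le_sq_mul_sq _ _ _
    rw [Real.norm_eq_abs]
    apply abs_le_of_sq_le_sq _ (by positivity)
    rw [mul_pow, Real.sq_sqrt (grsq_nonneg f x)]
    exact h2
  calc ‖fderiv ℝ f x‖^2 ≤ (Real.sqrt (grsq f x))^2 := pow_le_pow_left₀ (norm_nonneg _) h 2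
    _ = grsq f x := Real.sq_sqrt (grsq_nonneg f x)

/-! ### Energy -/

/-- Pointwise energy density. -/
def En (u : E7 → ℝ) (x : E7) : ℝ :=
  (mw x)^2 * (u x)^2 + mw x * grsq u x + (lap u x)^2 + grsq (lap u) x + (lap (lap u) x)^2

/-- The density of `HnormSq`. -/
def nd (u : E7 → ℝ) (x : E7) : ℝ := (lap u x)^2 + (lap (lap u) x)^2

/-- Vector field used for the Rellich-type inequality. -/
def Y1 (u : E7 → ℝ) (i : Fin 7) (y : E7) : ℝ :=
  (mw y * (u y * pd i u y) + y i * (cb * ((mw y * mw y) * (u y * u y))))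
    + lap u y * pd i (lap u) y

theorem sm_Y1 {u : E7 → ℝ} (hu : Sm u) (i : Fin 7) : Sm (Y1 u i) :=
  ((sm_mw.mul (hu.mul (hu.pd i))).add
    ((sm_coord i).mul (contDiff_const.mul ((sm_mw.mul sm_mw).mul (hu.mul hu))))).add
    (hu.lap.mul (hu.lap.pd i))

theorem cs_Y1 {u : E7 → ℝ} (hu : Sm u) (hc : HasCompactSupport u) (i : Fin 7) :
    HasCompactSupport (Y1 u i) := by
  refine HasCompactSupport.add (HasCompactSupport.add ?_ ?_) ?_
  · exact HasCompactSupport.mul_left (hc.mul_right)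
  · exact HasCompactSupport.mul_left (HasCompactSupport.mul_left
      (HasCompactSupport.mul_left (hc.mul_right)))
  · exact (cs_lap hu hc).mul_right

theorem En_le {u : E7 → ℝ} (hu : Sm u) (x : E7) :
    En u x ≤ 2 * nd u x + ∑ i, pd i (Y1 u i) x := by
  have h : ∑ i, pd i (Y1 u i) x = ∑ i, pd i (fun y => mw y * (u y * pd i u y)) x
      + ∑ i, pd i (fun y : E7 => y i * (cb * ((mw y * mw y) * (u y * u y)))) x
      + ∑ i, pd i (fun y => lap u y * pd i (lap u) y) x := by
    rw [← Finset.sum_add_distrib, ← Finset.sum_add_distrib]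
    refine Finset.sum_congr rfl fun i _ => ?_
    have a1 := sm_mw.mul (hu.mul (hu.pd i))
    have a2 : Sm (fun y : E7 => y i * (cb * ((mw y * mw y) * (u y * u y)))) :=
      (sm_coord i).mul (contDiff_const.mul ((sm_mw.mul sm_mw).mul (hu.mul hu)))
    have a3 := hu.lap.mul (hu.lap.pd i)
    rw [← pd_add a1 a2, ← pd_add (a1.add a2) a3]
    rfl
  rw [h, div_m hu, div_x hu, div_grad hu.lap]
  unfold En nd
  have hm := mw_pos x
  have hb := cb_pos
  have hb2 : 2 ≤ cb := by nlinarith [cb_sq]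
  have ha := ca_pos
  have p1 : 0 ≤ cb * (u x)^2 * (4 * ca * (mw x)^3) := by positivity
  have p2 : 2 * ((u x)^2 * (mw x)^2) ≤ cb * ((u x)^2 * (mw x)^2) :=
    mul_le_mul_of_nonneg_right hb2 (by positivity)
  nlinarith [sq_nonneg (mw x * u x + lap u x), sq_nonneg (lap u x + lap (lap u) x),
    sq_nonneg (mw x * u x)]

theorem q_grsq_le {f : E7 → ℝ} (hf : Sm f) (x : E7) :
    qw x * grsq f x ≤ (1 + 4 * cb / ca) * (qw x * (f x)^2 + qw x * (lap f x)^2)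
      + 2 * ∑ i, pd i (fun y => qw y * (f y * pd i f y)) x := by
  rw [div_q hf]
  have hq := qw_pos x
  have hb := cb_pos
  have ha := ca_pos
  have h1 : cb * ‖x‖^2 * grsq f x ≤ qw x * grsq f x := by
    apply mul_le_mul_of_nonneg_right _ (grsq_nonneg f x)
    unfold qw; linarith
  have h2 := mul_le_mul_of_nonneg_left (eul_sq f x) hb.le
  have h3 : cb * (f x)^2 ≤ cb / ca * (qw x * (f x)^2) := by
    rw [div_mul_eq_mul_div, le_div_iff₀ ha]
    have := mul_le_mul_of_nonneg_right (ca_le_qw x) (mul_nonneg hb.le (sq_nonneg (f x)))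
    linarith
  have h4 : 0 ≤ cb / ca * (qw x * (lap f x)^2) := by positivity
  have h5 : 0 ≤ qw x * (f x + lap f x)^2 := by positivity
  have h6 : 0 ≤ cb * (2 * f x + eul f x)^2 := by positivity
  have e : 4 * cb / ca = 4 * (cb / ca) := by ring
  rw [e]
  nlinarith

/-! ### Pointwise bounds -/

/-- A quantity whose weighted square is controlled by the energy density. -/
def Good (t : (E7 → ℝ) → E7 → ℝ) : Prop :=
  ∃ K : ℝ, 0 ≤ K ∧ ∀ u x, qw x * (t u x)^2 ≤ K * En u x

theorem Good.add {t s : (E7 → ℝ) → E7 → ℝ} (ht : Good t) (hs : Good s) :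
    Good (fun u x => t u x + s u x) := by
  obtain ⟨K, hK, h1⟩ := ht
  obtain ⟨K', hK', h2⟩ := hs
  refine ⟨2 * K + 2 * K', by positivity, fun u x => ?_⟩
  have a := h1 u x
  have b := h2 u x
  have : 0 ≤ qw x * (t u x - s u x)^2 := mul_nonneg (qw_pos x).le (sq_nonneg _)
  nlinarith

open Polynomial in
theorem good_mul {k : ℕ} {P : ℝ[X]} (hP : X^k ∣ P) {y : (E7 → ℝ) → E7 → ℝ}
    (hy : ∃ K : ℝ, 0 ≤ K ∧ ∀ u x, (mw x)^(2*k) * qw x * (y u x)^2 ≤ K * En u x) :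
    Good (fun u x => Fm P x * y u x) := by
  obtain ⟨K, hK, h⟩ := hy
  obtain ⟨M, hM, hF⟩ := Fm_bound hP
  refine ⟨M * K, mul_nonneg hM hK, fun u x => ?_⟩
  have h1 := mul_le_mul_of_nonneg_right (hF x)
    (mul_nonneg (qw_pos x).le (sq_nonneg (y u x)))
  have h2 := mul_le_mul_of_nonneg_left (h u x) hM
  nlinarith

theorem En_parts (u : E7 → ℝ) (x : E7) :
    (mw x)^2 * (u x)^2 ≤ En u x ∧ mw x * grsq u x ≤ En u x ∧ (lap u x)^2 ≤ En u x ∧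
    grsq (lap u) x ≤ En u x ∧ (lap (lap u) x)^2 ≤ En u x ∧ 0 ≤ En u x := by
  have h1 : 0 ≤ (mw x)^2 * (u x)^2 := by positivity
  have h2 : 0 ≤ mw x * grsq u x := mul_nonneg (mw_pos x).le (grsq_nonneg u x)
  have h3 := sq_nonneg (lap u x)
  have h4 := grsq_nonneg (lap u) x
  have h5 := sq_nonneg (lap (lap u) x)
  unfold En
  refine ⟨?_, ?_, ?_, ?_, ?_, ?_⟩ <;> linarith

theorem b_u : ∃ K : ℝ, 0 ≤ K ∧ ∀ (u : E7 → ℝ) x, (mw x)^(2*2) * qw x * (u x)^2 ≤ K * En u x := by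
  have ha := ca_pos
  refine ⟨ca⁻¹, by positivity, fun u x => ?_⟩
  obtain ⟨h, -⟩ := En_parts u x
  have hm := mw_pos x
  have e : (mw x)^(2*2) * qw x * (u x)^2 = mw x * ((mw x)^2 * (u x)^2) := by
    linear_combination ((mw x)^3 * (u x)^2) * mw_qw x
  rw [e]
  exact mul_le_mul (mw_le x) h (by positivity) (by positivity)

theorem b_eul : ∃ K : ℝ, 0 ≤ K ∧ ∀ (u : E7 → ℝ) x,
    (mw x)^(2*2) * qw x * (eul u x)^2 ≤ K * En u x := by
  have ha := ca_pos
  have hb := cb_pos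
  refine ⟨cb⁻¹ * ca⁻¹, by positivity, fun u x => ?_⟩
  obtain ⟨-, h, -⟩ := En_parts u x
  have hm := mw_pos x
  have hg := grsq_nonneg u x
  have e : (mw x)^(2*2) * qw x * (eul u x)^2 = (mw x)^3 * (eul u x)^2 := by
    linear_combination ((mw x)^3 * (eul u x)^2) * mw_qw x
  rw [e]
  calc (mw x)^3 * (eul u x)^2 ≤ (mw x)^3 * (‖x‖^2 * grsq u x) :=
        mul_le_mul_of_nonneg_left (eul_sq u x) (by positivity)
    _ = (‖x‖^2 * mw x) * mw x * (mw x * grsq u x) := by ring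
    _ ≤ cb⁻¹ * ca⁻¹ * En u x :=
        mul_le_mul (mul_le_mul (s_mw_le x) (mw_le x) hm.le (by positivity)) h (by positivity)
          (by positivity)

theorem b_lap : ∃ K : ℝ, 0 ≤ K ∧ ∀ (u : E7 → ℝ) x,
    (mw x)^(2*1) * qw x * (lap u x)^2 ≤ K * En u x := by
  have ha := ca_pos
  refine ⟨ca⁻¹, by positivity, fun u x => ?_⟩
  obtain ⟨-, -, h, -⟩ := En_parts u x
  have hm := mw_pos x
  have e : (mw x)^(2*1) * qw x * (lap u x)^2 = mw x * (lap u x)^2 := by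
    linear_combination (mw x * (lap u x)^2) * mw_qw x
  rw [e]
  exact mul_le_mul (mw_le x) h (by positivity) (by positivity)

theorem b_laplap : ∃ K : ℝ, 0 ≤ K ∧ ∀ (u : E7 → ℝ) x,
    (mw x)^(2*1) * qw x * (lap (lap u) x)^2 ≤ K * En u x := by
  have ha := ca_pos
  refine ⟨ca⁻¹, by positivity, fun u x => ?_⟩
  obtain ⟨-, -, -, -, h, -⟩ := En_parts u x
  have hm := mw_pos x
  have e : (mw x)^(2*1) * qw x * (lap (lap u) x)^2 = mw x * (lap (lap u) x)^2 := by
    linear_combination (mw x * (lap (lap u) x)^2) * mw_qw x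
  rw [e]
  exact mul_le_mul (mw_le x) h (by positivity) (by positivity)

theorem b_eullap : ∃ K : ℝ, 0 ≤ K ∧ ∀ (u : E7 → ℝ) x,
    (mw x)^(2*2) * qw x * (eul (lap u) x)^2 ≤ K * En u x := by
  have ha := ca_pos
  have hb := cb_pos
  refine ⟨cb⁻¹ * ca⁻¹ * ca⁻¹, by positivity, fun u x => ?_⟩
  obtain ⟨-, -, -, h, -⟩ := En_parts u x
  have hm := mw_pos x
  have hg := grsq_nonneg (lap u) x
  have e : (mw x)^(2*2) * qw x * (eul (lap u) x)^2 = (mw x)^3 * (eul (lap u) x)^2 := by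
    linear_combination ((mw x)^3 * (eul (lap u) x)^2) * mw_qw x
  rw [e]
  calc (mw x)^3 * (eul (lap u) x)^2 ≤ (mw x)^3 * (‖x‖^2 * grsq (lap u) x) :=
        mul_le_mul_of_nonneg_left (eul_sq (lap u) x) (by positivity)
    _ = (‖x‖^2 * mw x) * mw x * mw x * grsq (lap u) x := by ring
    _ ≤ cb⁻¹ * ca⁻¹ * ca⁻¹ * En u x :=
        mul_le_mul (mul_le_mul (mul_le_mul (s_mw_le x) (mw_le x) hm.le (by positivity))
          (mw_le x) hm.le (by positivity)) h hg (by positivity)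

theorem b_slap : ∃ K : ℝ, 0 ≤ K ∧ ∀ (u : E7 → ℝ) x,
    (mw x)^(2*3) * qw x * (‖x‖^2 * lap u x)^2 ≤ K * En u x := by
  have ha := ca_pos
  have hb := cb_pos
  refine ⟨(cb⁻¹)^2 * (ca⁻¹)^3, by positivity, fun u x => ?_⟩
  obtain ⟨-, -, h, -⟩ := En_parts u x
  have hm := mw_pos x
  have e : (mw x)^(2*3) * qw x * (‖x‖^2 * lap u x)^2
      = (‖x‖^2 * mw x)^2 * (mw x)^3 * (lap u x)^2 := by
    linear_combination ((mw x)^5 * (‖x‖^2 * lap u x)^2) * mw_qw x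
  rw [e]
  exact mul_le_mul (mul_le_mul (pow_le_pow_left₀ (by positivity) (s_mw_le x) 2)
    (pow_le_pow_left₀ hm.le (mw_le x) 3) (by positivity) (by positivity)) h (by positivity)
    (by positivity)

/-- The function `Δ(Vu)`. -/
def fV (u : E7 → ℝ) (x : E7) : ℝ :=
  Fm PV x * lap u x + Fm (gam PV) x * eul u x + Fm (etp PV) x * u x

theorem lapV {u : E7 → ℝ} (hu : Sm u) : lap (fun x => Vpot ‖x‖ * u x) = fV u := by
  simp_rw [Vpot_eq]
  exact funext (lap_Fm_mul PV hu)

theorem good_fV : Good fV :=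
  ((good_mul dvd_PV b_lap).add (good_mul (dvd_gam dvd_PV) b_eul)).add
    (good_mul (dvd_etp dvd_PV) b_u)

/-- The function `Δ²(Vu)`. -/
def gV (u : E7 → ℝ) (x : E7) : ℝ :=
  ((Fm PV x * lap (lap u) x + Fm (gam PV) x * eul (lap u) x + Fm (etp PV) x * lap u x)
  + (((Fm (gam PV) x * lap u x + Fm (gam PV) x * lap u x) + Fm (gam PV) x * eul (lap u) x)
    + (Fm (gam (gam PV)) x * (‖x‖^2 * lap u x) + Fm (-5 * gam (gam PV)) x * eul u x)
    + Fm (etp (gam PV)) x * eul u x))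
  + (Fm (etp PV) x * lap u x + Fm (gam (etp PV)) x * eul u x + Fm (etp (etp PV)) x * u x)

theorem sm_fV {u : E7 → ℝ} (hu : Sm u) : Sm (fV u) :=
  (((sm_Fm _).mul hu.lap).add ((sm_Fm _).mul hu.eul)).add ((sm_Fm _).mul hu)

theorem lap_fV {u : E7 → ℝ} (hu : Sm u) (hr : IsRadial u) (x : E7) : lap (fV u) x = gV u x := by
  have a1 := (sm_Fm PV).mul hu.lap
  have a2 := (sm_Fm (gam PV)).mul hu.eul
  have a3 := (sm_Fm (etp PV)).mul hu
  have h5 : Fm (-5 * gam (gam PV)) x = -5 * Fm (gam (gam PV)) x := by simp [Fm]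
  have : lap (fV u) x = lap (fun z => Fm PV z * lap u z) x
      + lap (fun z => Fm (gam PV) z * eul u z) x + lap (fun z => Fm (etp PV) z * u z) x := by
    rw [← lap_add a1 a2, ← lap_add (a1.add a2) a3]; rfl
  rw [this, lap_Fm_mul _ hu.lap, lap_Fm_mul _ hu.eul, lap_Fm_mul _ hu, lap_eul hu hr,
    eul_eul hu hr]
  unfold gV
  rw [h5]
  ring

theorem good_gV : Good gV := by
  have d1 := dvd_PV
  have d2 := dvd_gam d1
  have d2' := dvd_etp d1
  have d3 := dvd_gam d2
  have e1 : (Polynomial.X : Polynomial ℝ)^1 ∣ gam PV := (pow_dvd_pow _ (by norm_num)).trans d2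
  have e2 : (Polynomial.X : Polynomial ℝ)^1 ∣ etp PV := (pow_dvd_pow _ (by norm_num)).trans d2'
  have e3 : (Polynomial.X : Polynomial ℝ)^2 ∣ -5 * gam (gam PV) :=
    ((pow_dvd_pow _ (by norm_num)).trans d3).mul_left _
  have e4 : (Polynomial.X : Polynomial ℝ)^2 ∣ etp (gam PV) :=
    (pow_dvd_pow _ (by norm_num)).trans (dvd_etp d2)
  have e5 : (Polynomial.X : Polynomial ℝ)^2 ∣ gam (etp PV) :=
    (pow_dvd_pow _ (by norm_num)).trans (dvd_gam d2')
  have e6 : (Polynomial.X : Polynomial ℝ)^2 ∣ etp (etp PV) :=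
    (pow_dvd_pow _ (by norm_num)).trans (dvd_etp d2')
  exact ((((good_mul d1 b_laplap).add (good_mul d2 b_eullap)).add (good_mul e2 b_lap)).add
    (((((good_mul e1 b_lap).add (good_mul e1 b_lap)).add (good_mul d2 b_eullap)).add
      ((good_mul d3 b_slap).add (good_mul e3 b_eul))).add (good_mul e4 b_eul))).add
    (((good_mul e2 b_lap).add (good_mul e5 b_eul)).add (good_mul e6 b_u))

/-! ### Main estimate -/

/-- Weighted target density. -/
def td (f : E7 → ℝ) (x : E7) : ℝ := qw x * ((f x)^2 + grsq f x + (lap f x)^2)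

theorem td_nonneg (f : E7 → ℝ) (x : E7) : 0 ≤ td f x :=
  mul_nonneg (qw_pos x).le (add_nonneg (add_nonneg (sq_nonneg _) (grsq_nonneg f x)) (sq_nonneg _))

theorem cs_sq {f : E7 → ℝ} (h : HasCompactSupport f) : HasCompactSupport (fun x => (f x)^2) := by
  simp_rw [pow_two]; exact h.mul_right

theorem sm_grsq {f : E7 → ℝ} (h : Sm f) : Sm (grsq f) := ContDiff.sum fun i _ => (h.pd i).pow 2

theorem int_td {f : E7 → ℝ} (h : Sm f) (hc : HasCompactSupport f) : Integrable (td f) := by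
  have h1 : Sm (td f) := sm_qw.mul (((h.pow 2).add (sm_grsq h)).add (h.lap.pow 2))
  refine h1.continuous.integrable_of_hasCompactSupport ?_
  exact HasCompactSupport.mul_left (((cs_sq hc).add (cs_sum fun i => cs_sq (cs_pd hc i))).add
    (cs_sq (cs_lap h hc)))

theorem int_sq {f : E7 → ℝ} (h : Sm f) (hc : HasCompactSupport f) :
    Integrable (fun x => (f x)^2) :=
  (h.pow 2).continuous.integrable_of_hasCompactSupport (cs_sq hc)

theorem int_nd {u : E7 → ℝ} (h : Sm u) (hc : HasCompactSupport u) : Integrable (nd u) :=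
  (int_sq h.lap (cs_lap h hc)).add (int_sq h.lap.lap (cs_lap h.lap (cs_lap h hc)))

theorem cs_fV {u : E7 → ℝ} (h : Sm u) (hc : HasCompactSupport u) : HasCompactSupport (fV u) :=
  ((HasCompactSupport.mul_left (cs_lap h hc)).add
    (HasCompactSupport.mul_left (cs_sum fun i => HasCompactSupport.mul_left (cs_pd hc i)))).add
    (HasCompactSupport.mul_left hc)

theorem main_real : ∃ K : ℝ, 0 < K ∧ ∀ u : E7 → ℝ, Sm u → HasCompactSupport u → IsRadial u →
    ∫ x, td (fV u) x ≤ K * ∫ x, nd u x := by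
  obtain ⟨K1, hK1, h1⟩ := good_fV
  obtain ⟨K2, hK2, h2⟩ := good_gV
  have ha := ca_pos
  have hb := cb_pos
  set c : ℝ := 2 + 4 * cb / ca with hcdef
  have hc0 : 0 < c := by positivity
  set K : ℝ := c * (K1 + K2) with hK
  have hK0 : 0 ≤ K := by positivity
  refine ⟨2 * K + 1, by positivity, fun u hu hc hr => ?_⟩
  have hf := sm_fV hu
  have hfc := cs_fV hu hc
  have hnn : 0 ≤ ∫ x, nd u x := integral_nonneg fun x => by
    unfold nd; positivity
  have key : ∫ x, td (fV u) x ≤ ∫ x, (2 * K) * nd u x := by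
    refine ibp_le (Y := fun i y => K * Y1 u i y + 2 * (qw y * (fV u y * pd i (fV u) y)))
      (int_td hf hfc) ((int_nd hu hc).const_mul _) ?_ ?_ ?_
    · intro i
      exact (contDiff_const.mul (sm_Y1 hu i)).add
        (contDiff_const.mul (sm_qw.mul (hf.mul (hf.pd i))))
    · intro i
      exact (HasCompactSupport.mul_left (cs_Y1 hu hc i)).add
        (HasCompactSupport.mul_left (HasCompactSupport.mul_left hfc.mul_right))
    · intro x
      have e : ∑ i, pd i (fun y => K * Y1 u i y + 2 * (qw y * (fV u y * pd i (fV u) y))) x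
          = K * ∑ i, pd i (Y1 u i) x
            + 2 * ∑ i, pd i (fun y => qw y * (fV u y * pd i (fV u) y)) x := by
        rw [Finset.mul_sum, Finset.mul_sum, ← Finset.sum_add_distrib]
        refine Finset.sum_congr rfl fun i _ => ?_
        have b1 := sm_Y1 hu i
        have b2 := sm_qw.mul (hf.mul (hf.pd i))
        rw [pd_add (contDiff_const.mul b1) (contDiff_const.mul b2), pd_const_mul b1,
          pd_const_mul b2]
      rw [e]
      have g1 := q_grsq_le hf x
      have g2 := h1 u x
      have g3 := h2 u x
      rw [← lap_fV hu hr] at g3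
      have g4 := mul_le_mul_of_nonneg_left (En_le hu x) hK0
      have g5 : c * (qw x * (fV u x)^2 + qw x * (lap (fV u) x)^2) ≤ K * En u x := by
        rw [hK, mul_assoc]
        apply mul_le_mul_of_nonneg_left _ hc0.le
        linarith
      have g6 : td (fV u) x = qw x * grsq (fV u) x
          + (qw x * (fV u x)^2 + qw x * (lap (fV u) x)^2) := by unfold td; ring
      have g7 : c = 1 + (1 + 4 * cb / ca) := by rw [hcdef]; ring
      rw [g7] at g5
      rw [g6]
      linarith
  rw [integral_const_mul] at key
  linarith

theorem sqrt_bound {A B : ℝ≥0∞} {k r : ℝ} (hk : 0 ≤ k) (hr : 0 < r)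
    (h : A ≤ ENNReal.ofReal (k / r^2) * B) :
    A ^ ((1:ℝ)/2) ≤ ENNReal.ofReal (Real.sqrt k / r) * B ^ ((1:ℝ)/2) := by
  refine (ENNReal.rpow_le_rpow h (by norm_num)).trans (le_of_eq ?_)
  rw [ENNReal.mul_rpow_of_nonneg _ _ (by norm_num),
    ENNReal.ofReal_rpow_of_nonneg (by positivity) (by norm_num), ← Real.sqrt_eq_rpow,
    Real.sqrt_div hk, Real.sqrt_sq hr.le]

theorem final_set {K : ℝ} (hK : 0 < K) {u : E7 → ℝ} (hu : Sm u) (hc : HasCompactSupport u)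
    (h : ∫ x, td (fV u) x ≤ K * ∫ x, nd u x) (S : Set E7) (hS : MeasurableSet S)
    (r : ℝ) (hr : 0 < r) (hq : ∀ x ∈ S, ca * r^2 ≤ qw x) :
    (H1normSq (fV u) S) ^ ((1:ℝ)/2)
      + (∫⁻ x in S, ENNReal.ofReal ((lap (fV u) x)^2)) ^ ((1:ℝ)/2)
      ≤ ENNReal.ofReal (2 * Real.sqrt (K / ca) / r) * Hnorm u := by
  have ha := ca_pos
  have hf := sm_fV hu
  have hfc := cs_fV hu hc
  have hN : HnormSq u = ENNReal.ofReal (∫ x, nd u x) := by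
    have i1 := int_sq hu.lap (cs_lap hu hc)
    have i2 := int_sq hu.lap.lap (cs_lap hu.lap (cs_lap hu hc))
    unfold HnormSq nd
    rw [integral_add i1 i2, ENNReal.ofReal_add (integral_nonneg fun x => sq_nonneg _)
      (integral_nonneg fun x => sq_nonneg _),
      ofReal_integral_eq_lintegral_ofReal i1 (Filter.Eventually.of_forall fun x => sq_nonneg _),
      ofReal_integral_eq_lintegral_ofReal i2 (Filter.Eventually.of_forall fun x => sq_nonneg _)]
  -- the general estimate
  have gen : ∀ g : E7 → ℝ, (∀ x, qw x * g x ≤ td (fV u) x) → (∀ x, 0 ≤ g x) →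
      ∫⁻ x in S, ENNReal.ofReal (g x) ≤ ENNReal.ofReal (K / ca / r^2) * HnormSq u := by
    intro g hg hg0
    calc ∫⁻ x in S, ENNReal.ofReal (g x)
        ≤ ∫⁻ x in S, ENNReal.ofReal ((ca * r^2)⁻¹ * td (fV u) x) := by
          refine setLIntegral_mono' hS fun x hx => ENNReal.ofReal_le_ofReal ?_
          rw [inv_mul_eq_div, le_div_iff₀ (by positivity)]
          have := mul_le_mul_of_nonneg_right (hq x hx) (hg0 x)
          have := hg x
          linarith
      _ ≤ ∫⁻ x, ENNReal.ofReal ((ca * r^2)⁻¹ * td (fV u) x) := setLIntegral_le_lintegral _ _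
      _ = ENNReal.ofReal (∫ x, (ca * r^2)⁻¹ * td (fV u) x) := by
          rw [ofReal_integral_eq_lintegral_ofReal ((int_td hf hfc).const_mul _)]
          exact Filter.Eventually.of_forall fun x => mul_nonneg (by positivity) (td_nonneg _ _)
      _ ≤ ENNReal.ofReal (K / ca / r^2 * ∫ x, nd u x) := by
          refine ENNReal.ofReal_le_ofReal ?_
          rw [integral_const_mul]
          refine (mul_le_mul_of_nonneg_left h (by positivity)).trans (le_of_eq ?_)
          field_simp
      _ = ENNReal.ofReal (K / ca / r^2) * HnormSq u := by
          rw [hN, ENNReal.ofReal_mul (by positivity)]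
  have hH1 : H1normSq (fV u) S ≤ ENNReal.ofReal (K / ca / r^2) * HnormSq u := by
    unfold H1normSq
    have hme : Measurable (fun x => ENNReal.ofReal ((fV u x)^2)) :=
      (hf.continuous.pow 2).measurable.ennreal_ofReal
    rw [← lintegral_add_left hme]
    simp_rw [← ENNReal.ofReal_add (sq_nonneg _) (sq_nonneg _)]
    refine gen _ (fun x => ?_) (fun x => by positivity)
    refine mul_le_mul_of_nonneg_left ?_ (qw_pos x).le
    have := fderiv_sq_le (fV u) x
    have := sq_nonneg (lap (fV u) x)
    linarith
  have hL : ∫⁻ x in S, ENNReal.ofReal ((lap (fV u) x)^2)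
      ≤ ENNReal.ofReal (K / ca / r^2) * HnormSq u := by
    refine gen _ (fun x => ?_) (fun x => by positivity)
    refine mul_le_mul_of_nonneg_left ?_ (qw_pos x).le
    have := grsq_nonneg (fV u) x
    have := sq_nonneg (fV u x)
    linarith
  refine (add_le_add (sqrt_bound (by positivity) hr hH1) (sqrt_bound (by positivity) hr hL)).trans
    (le_of_eq ?_)
  rw [← add_mul, ← ENNReal.ofReal_add (by positivity) (by positivity), Hnorm]
  congr 2
  ring

/-- Bounds for the multiplication operator `u ↦ V(|·|)u`: there is `C > 0` so that for
every radial `u ∈ C_c^∞(ℝ⁷)` and every `R ≥ 1`,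
`‖Δ(Vu)‖_{H¹(ℝ⁷)} + ‖Δ²(Vu)‖_{L²(ℝ⁷)} ≤ C‖u‖` and
`‖Δ(Vu)‖_{H¹(ℝ⁷∖B_R)} + ‖Δ²(Vu)‖_{L²(ℝ⁷∖B_R)} ≤ C R⁻¹ ‖u‖`. -/
theorem stmt10 :
    ∃ C : ℝ, 0 < C ∧ ∀ u : E7 → ℝ,
      ContDiff ℝ (⊤ : ℕ∞) u → HasCompactSupport u → IsRadial u →
      ∀ R : ℝ, 1 ≤ R →
        ((H1normSq (lap (fun x => Vpot ‖x‖ * u x)) univ) ^ ((1:ℝ)/2)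
            + (∫⁻ x, ENNReal.ofReal ((lap (lap (fun x => Vpot ‖x‖ * u x)) x)^2)) ^ ((1:ℝ)/2)
          ≤ ENNReal.ofReal C * Hnorm u) ∧
        ((H1normSq (lap (fun x => Vpot ‖x‖ * u x)) ((Metric.ball (0:E7) R)ᶜ)) ^ ((1:ℝ)/2)
            + (∫⁻ x in (Metric.ball (0:E7) R)ᶜ,
                ENNReal.ofReal ((lap (lap (fun x => Vpot ‖x‖ * u x)) x)^2)) ^ ((1:ℝ)/2)
          ≤ ENNReal.ofReal (C / R) * Hnorm u) := by
  obtain ⟨K, hK, hmain⟩ := main_real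
  have ha := ca_pos
  refine ⟨2 * Real.sqrt (K / ca), by positivity, fun u hu hc hr R hR => ?_⟩
  have h := hmain u hu hc hr
  rw [lapV hu]
  constructor
  · have := final_set hK hu hc h univ MeasurableSet.univ 1 one_pos
      (fun x _ => by simpa using ca_le_qw x)
    simpa only [Measure.restrict_univ, div_one] using this
  · refine final_set hK hu hc h _ Metric.isOpen_ball.measurableSet.compl R (by linarith) ?_
    intro x hx
    have hx' : R ≤ ‖x‖ := by simpa using hx
    have h1 : R^2 ≤ ‖x‖^2 := pow_le_pow_left₀ (by linarith) hx' 2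
    have h2 : ca * R^2 ≤ cb * ‖x‖^2 := mul_le_mul ca_le_cb h1 (by positivity) cb_pos.le
    unfold qw
    linarith

end
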